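/- arXiv:1903.11514 — 2 statements merged into one kernel-verified Lean document; each statement's English description precedes it below -/
import Mathlib

section
/- Fix ρ > 0, an integer N ≥ 1 with M = ⌊ρN⌋ ≥ 1, and δ ∈ (0,1). With respect to the uniform probability measure on [0,2]^M (normalized Lebesgue measure), the set {(ω₁,…,ω_M) ∈ [0,2]^M : ES_N(ω₁,…,ω_M) > N^(−δ)} has probability at most 16·ρ²·N^(δ−1). -/
open scoped BigOperators ENNReal
open MeasureTheory

/-- `e[t] = exp(2πit)`. -/
noncomputable def expc (t : ℝ) : ℂ := Complex.exp (2 * Real.pi * Complex.I * t)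

/-- The exponential sum `ES_N(ω)` with parameter `ρ`. -/
noncomputable def ES (ρ : ℝ) (ω : ℕ → ℝ) (N : ℕ) : ℂ :=
  ((N : ℂ) ^ 5)⁻¹ *
    ∑ i₁ ∈ Finset.Icc 1 ⌊ρ * (N : ℝ)⌋₊, ∑ i₂ ∈ Finset.Icc 1 ⌊ρ * (N : ℝ)⌋₊,
      ∑ j₁ ∈ Finset.Icc 1 N, ∑ j₂ ∈ Finset.Icc 1 N,
        ∑ j₃ ∈ Finset.Icc 1 N, ∑ j₄ ∈ Finset.Icc 1 N,
          if j₁ + j₃ = j₂ + j₄ then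
            expc ((ω i₁ - ω i₂) / 2 *
              ((j₁ : ℝ) ^ 2 - (j₂ : ℝ) ^ 2 + (j₃ : ℝ) ^ 2 - (j₄ : ℝ) ^ 2))
          else 0

/-- `‖x‖_T`, the distance from `x` to the nearest integer. -/
noncomputable def distT (x : ℝ) : ℝ := |x - round x|

/-- Extension of a vector `v ∈ ℝ^M` to a sequence indexed by `ℕ`, so that the entry
indexed by `i ∈ {1,…,M}` is `v_{i}`. -/
def extFin (M : ℕ) (v : Fin M → ℝ) : ℕ → ℝ :=
  fun i => if h : i - 1 < M then v ⟨i - 1, h⟩ else 0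

lemma expc_zero : expc 0 = 1 := by simp [expc]

lemma expc_add (s t : ℝ) : expc (s + t) = expc s * expc t := by
  simp only [expc, ← Complex.exp_add]
  push_cast
  ring_nf

lemma norm_expc (t : ℝ) : ‖expc t‖ = 1 := by
  rw [expc, Complex.norm_exp]
  simp

lemma conj_expc (t : ℝ) : (starRingEnd ℂ) (expc t) = expc (-t) := by
  simp [expc, ← Complex.exp_conj, map_ofNat]

lemma continuous_expc : Continuous expc := by
  unfold expc
  fun_prop

/-- The orthogonality relation for the characters `x ↦ e[x k / 2]` on `[0, 2]`. -/
lemma setIntegral_expc_half_mul_int {k : ℤ} (hk : k ≠ 0) :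
    ∫ x in Set.Icc (0 : ℝ) 2, expc (x / 2 * k) = 0 := by
  rw [integral_Icc_eq_integral_Ioc, ← intervalIntegral.integral_of_le (by norm_num)]
  have hc : (Real.pi * Complex.I * k : ℂ) ≠ 0 := by
    simp [Real.pi_ne_zero, hk]
  have h : ∀ x : ℝ, expc (x / 2 * k) = Complex.exp ((Real.pi * Complex.I * k : ℂ) * x) := by
    intro x
    simp only [expc]
    push_cast
    ring_nf
  simp only [h]
  rw [integral_exp_mul_complex hc]
  have h2 : (Real.pi * Complex.I * k : ℂ) * (2 : ℝ) = k * (2 * Real.pi * Complex.I) := by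
    push_cast
    ring
  rw [h2, Complex.exp_int_mul_two_pi_mul_I]
  simp

/-- The contribution to `ES` of a pair of frequencies with difference `x`. -/
noncomputable def pairSum (N : ℕ) (x : ℝ) : ℂ :=
  ∑ j₁ ∈ Finset.Icc 1 N, ∑ j₂ ∈ Finset.Icc 1 N,
    ∑ j₃ ∈ Finset.Icc 1 N, ∑ j₄ ∈ Finset.Icc 1 N,
      if j₁ + j₃ = j₂ + j₄ then
        expc (x / 2 * ((j₁ : ℝ) ^ 2 - (j₂ : ℝ) ^ 2 + (j₃ : ℝ) ^ 2 - (j₄ : ℝ) ^ 2))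
      else 0

lemma pairSum_eq_sum_norm_sq (N : ℕ) (x : ℝ) :
    pairSum N x = ((∑ s ∈ Finset.range (2 * N + 1),
      ‖∑ j₁ ∈ Finset.Icc 1 N, ∑ j₃ ∈ Finset.Icc 1 N,
        if j₁ + j₃ = s then expc (x / 2 * ((j₁ : ℝ) ^ 2 + (j₃ : ℝ) ^ 2)) else 0‖ ^ 2 : ℝ) : ℂ) := by
  have key : ∀ j₁ ∈ Finset.Icc 1 N, ∀ j₂ ∈ Finset.Icc 1 N, ∀ j₃ ∈ Finset.Icc 1 N,
      ∀ j₄ ∈ Finset.Icc 1 N,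
      (if j₁ + j₃ = j₂ + j₄ then
        expc (x / 2 * ((j₁ : ℝ) ^ 2 - (j₂ : ℝ) ^ 2 + (j₃ : ℝ) ^ 2 - (j₄ : ℝ) ^ 2))
      else 0) = ∑ s ∈ Finset.range (2 * N + 1),
        (if j₁ + j₃ = s then expc (x / 2 * ((j₁ : ℝ) ^ 2 + (j₃ : ℝ) ^ 2)) else 0) *
        (starRingEnd ℂ)
          (if j₂ + j₄ = s then expc (x / 2 * ((j₂ : ℝ) ^ 2 + (j₄ : ℝ) ^ 2)) else 0) := by
    intro j₁ h₁ j₂ h₂ j₃ h₃ j₄ h₄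
    rw [Finset.mem_Icc] at h₁ h₃
    rw [Finset.sum_eq_single (j₁ + j₃)]
    · by_cases h : j₁ + j₃ = j₂ + j₄
      · rw [if_pos h, if_pos rfl, if_pos h.symm, conj_expc, ← expc_add]
        congr 1
        ring
      · rw [if_neg h, if_neg (Ne.symm h)]
        simp
    · intro s _ hs
      rw [if_neg (Ne.symm hs), zero_mul]
    · intro h
      exact absurd (Finset.mem_range.mpr (by omega)) h
  push_cast
  simp only [← Complex.mul_conj', map_sum, Finset.sum_mul_sum]
  rw [pairSum]
  symm
  rw [Finset.sum_comm]
  refine Finset.sum_congr rfl fun j₁ h₁ => ?_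
  rw [Finset.sum_comm]
  refine Finset.sum_congr rfl fun j₂ h₂ => ?_
  rw [Finset.sum_comm]
  refine Finset.sum_congr rfl fun j₃ h₃ => ?_
  rw [Finset.sum_comm]
  exact Finset.sum_congr rfl fun j₄ h₄ => (key j₁ h₁ j₂ h₂ j₃ h₃ j₄ h₄).symm

lemma pairSum_re_nonneg (N : ℕ) (x : ℝ) : 0 ≤ (pairSum N x).re := by
  rw [pairSum_eq_sum_norm_sq, Complex.ofReal_re]
  positivity

lemma pairSum_re_le (N : ℕ) (x : ℝ) : (pairSum N x).re ≤ (N : ℝ) ^ 3 := by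
  refine (Complex.re_le_norm _).trans ?_
  have h : ∀ j₁ ∈ Finset.Icc 1 N, ∀ j₂ ∈ Finset.Icc 1 N, ∀ j₃ ∈ Finset.Icc 1 N,
      ‖∑ j₄ ∈ Finset.Icc 1 N, if j₁ + j₃ = j₂ + j₄ then
        expc (x / 2 * ((j₁ : ℝ) ^ 2 - (j₂ : ℝ) ^ 2 + (j₃ : ℝ) ^ 2 - (j₄ : ℝ) ^ 2)) else 0‖ ≤ 1 := by
    intro j₁ _ j₂ _ j₃ _
    refine (norm_sum_le _ _).trans ?_
    calc ∑ j₄ ∈ Finset.Icc 1 N, ‖if j₁ + j₃ = j₂ + j₄ then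
        expc (x / 2 * ((j₁ : ℝ) ^ 2 - (j₂ : ℝ) ^ 2 + (j₃ : ℝ) ^ 2 - (j₄ : ℝ) ^ 2)) else 0‖
        ≤ ∑ j₄ ∈ Finset.Icc 1 N, if j₁ + j₃ - j₂ = j₄ then (1 : ℝ) else 0 := by
          refine Finset.sum_le_sum fun j₄ _ => ?_
          by_cases hj : j₁ + j₃ = j₂ + j₄
          · rw [if_pos hj, if_pos (by omega), norm_expc]
          · rw [if_neg hj, norm_zero]
            split_ifs <;> norm_num
      _ ≤ 1 := by
          rw [Finset.sum_ite_eq]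
          split_ifs <;> norm_num
  calc ‖pairSum N x‖ ≤ ∑ j₁ ∈ Finset.Icc 1 N, ∑ j₂ ∈ Finset.Icc 1 N,
        ∑ j₃ ∈ Finset.Icc 1 N, (1 : ℝ) :=
        norm_sum_le_of_le _ fun j₁ h₁ => norm_sum_le_of_le _ fun j₂ h₂ =>
          norm_sum_le_of_le _ fun j₃ h₃ => h j₁ h₁ j₂ h₂ j₃ h₃
    _ = (N : ℝ) ^ 3 := by
        simp
        ring

lemma continuous_pairSum (N : ℕ) : Continuous (pairSum N) := by
  unfold pairSum
  refine continuous_finsetSum _ fun j₁ _ => continuous_finsetSum _ fun j₂ _ =>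
    continuous_finsetSum _ fun j₃ _ => continuous_finsetSum _ fun j₄ _ => ?_
  split_ifs
  · exact continuous_expc.comp (by fun_prop)
  · exact continuous_const

lemma eq_or_eq_of_add_eq_of_sq_add_eq {a b c d : ℤ} (h : a + c = b + d)
    (h2 : a ^ 2 - b ^ 2 + c ^ 2 - d ^ 2 = 0) : (b = a ∧ d = c) ∨ (d = a ∧ b = c) := by
  obtain rfl : d = a + c - b := by linarith
  have h3 : (a - b) * (b - c) = 0 := by linarith [show 2 * ((a - b) * (b - c)) = 0 by linarith]
  rcases mul_eq_zero.mp h3 with h4 | h4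
  · left; constructor <;> linarith
  · right; constructor <;> linarith

/-- Lebesgue measure, of total mass `2 ^ M`, on the cube `[0, 2] ^ M`. -/
noncomputable def cubeMeasure (M : ℕ) : Measure (Fin M → ℝ) :=
  Measure.pi fun _ => volume.restrict (Set.Icc (0 : ℝ) 2)

instance (M : ℕ) : IsFiniteMeasure (cubeMeasure M) := by
  unfold cubeMeasure
  infer_instance

lemma cubeMeasure_eq_restrict (M : ℕ) :
    cubeMeasure M = volume.restrict (Set.univ.pi fun _ : Fin M => Set.Icc (0 : ℝ) 2) := by
  rw [cubeMeasure, volume_pi, Measure.restrict_pi_pi]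

lemma cubeMeasure_real_univ (M : ℕ) : (cubeMeasure M).real Set.univ = 2 ^ M := by
  simp [cubeMeasure, Measure.real, Measure.pi_univ]

lemma Continuous.integrable_cubeMeasure {M : ℕ} {E : Type*} [NormedAddCommGroup E]
    {f : (Fin M → ℝ) → E} (hf : Continuous f) : Integrable f (cubeMeasure M) := by
  rw [cubeMeasure_eq_restrict]
  exact hf.continuousOn.integrableOn_compact (isCompact_univ_pi fun _ => isCompact_Icc)

lemma integral_expc_sub_eq_zero {M : ℕ} {a b : Fin M} (hab : a ≠ b) {k : ℤ} (hk : k ≠ 0) :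
    ∫ v, expc ((v a - v b) / 2 * k) ∂cubeMeasure M = 0 := by
  let f : Fin M → ℝ → ℂ := fun l x =>
    if l = a then expc (x / 2 * k) else if l = b then expc (-(x / 2 * k)) else 1
  have h : ∀ v : Fin M → ℝ, expc ((v a - v b) / 2 * k) = ∏ l, f l (v l) := by
    intro v
    rw [Fintype.prod_eq_mul a b hab]
    · simp only [f, if_true, if_neg hab.symm, ← expc_add]
      congr 1
      ring
    · rintro l ⟨h₁, h₂⟩
      simp [f, h₁, h₂]
  simp only [h, cubeMeasure]
  rw [integral_fintype_prod_eq_prod]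
  refine Finset.prod_eq_zero (Finset.mem_univ a) ?_
  simpa [f] using setIntegral_expc_half_mul_int hk

lemma integral_pairSum_re_le {M : ℕ} (N : ℕ) {a b : Fin M} (hab : a ≠ b) :
    ∫ v, (pairSum N (v a - v b)).re ∂cubeMeasure M ≤ 2 ^ M * (2 * (N : ℝ) ^ 2) := by
  have hterm : ∀ j₁ j₂ j₃ j₄ : ℕ, Continuous fun v : Fin M → ℝ =>
      (if j₁ + j₃ = j₂ + j₄ then expc ((v a - v b) / 2 *
        ((j₁ : ℝ) ^ 2 - (j₂ : ℝ) ^ 2 + (j₃ : ℝ) ^ 2 - (j₄ : ℝ) ^ 2)) else 0).re := by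
    intro j₁ j₂ j₃ j₄
    split_ifs
    · exact Complex.continuous_re.comp (continuous_expc.comp (by fun_prop))
    · exact continuous_const
  have hbound : ∀ j₁ j₂ j₃ j₄ : ℕ, ∫ v : Fin M → ℝ,
      (if j₁ + j₃ = j₂ + j₄ then expc ((v a - v b) / 2 *
        ((j₁ : ℝ) ^ 2 - (j₂ : ℝ) ^ 2 + (j₃ : ℝ) ^ 2 - (j₄ : ℝ) ^ 2)) else 0).re ∂cubeMeasure M
      ≤ 2 ^ M * ((if j₁ = j₂ then 1 else 0) * (if j₃ = j₄ then 1 else 0) +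
        (if j₁ = j₄ then 1 else 0) * (if j₃ = j₂ then 1 else 0)) := by
    intro j₁ j₂ j₃ j₄
    have hR : (0 : ℝ) ≤ 2 ^ M * ((if j₁ = j₂ then 1 else 0) * (if j₃ = j₄ then 1 else 0) +
        (if j₁ = j₄ then 1 else 0) * (if j₃ = j₂ then 1 else 0)) := by positivity
    by_cases h : j₁ + j₃ = j₂ + j₄
    swap
    · simpa only [if_neg h, Complex.zero_re, integral_zero] using hR
    simp only [if_pos h]
    let k : ℤ := (j₁ : ℤ) ^ 2 - (j₂ : ℤ) ^ 2 + (j₃ : ℤ) ^ 2 - (j₄ : ℤ) ^ 2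
    have hk : ((j₁ : ℝ) ^ 2 - (j₂ : ℝ) ^ 2 + (j₃ : ℝ) ^ 2 - (j₄ : ℝ) ^ 2) = (k : ℝ) := by
      simp [k]
    simp only [hk]
    by_cases hk0 : k = 0
    · have h1 : (1 : ℝ) ≤ (if j₁ = j₂ then 1 else 0) * (if j₃ = j₄ then 1 else 0) +
          (if j₁ = j₄ then 1 else 0) * (if j₃ = j₂ then 1 else 0) := by
        rcases eq_or_eq_of_add_eq_of_sq_add_eq (by exact_mod_cast h) hk0 with ⟨h₁, h₂⟩ | ⟨h₁, h₂⟩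
        · rw [if_pos (by omega : j₁ = j₂), if_pos (by omega : j₃ = j₄), one_mul]
          exact le_add_of_nonneg_right (by positivity)
        · rw [if_pos (by omega : j₁ = j₄), if_pos (by omega : j₃ = j₂), one_mul]
          exact le_add_of_nonneg_left (by positivity)
      simp only [hk0, Int.cast_zero, mul_zero, expc_zero, Complex.one_re, integral_const,
        cubeMeasure_real_univ, smul_eq_mul]
      gcongr
    · have hint : Integrable (fun v : Fin M → ℝ => expc ((v a - v b) / 2 * k)) (cubeMeasure M) :=
        (continuous_expc.comp (by fun_prop)).integrable_cubeMeasure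
      have h0 := integral_re hint
      rw [integral_expc_sub_eq_zero hab hk0] at h0
      simp only [RCLike.re_to_complex, Complex.zero_re] at h0
      rwa [h0]
  have hsum : ∀ v : Fin M → ℝ, (pairSum N (v a - v b)).re =
      ∑ j₁ ∈ Finset.Icc 1 N, ∑ j₂ ∈ Finset.Icc 1 N,
        ∑ j₃ ∈ Finset.Icc 1 N, ∑ j₄ ∈ Finset.Icc 1 N,
        (if j₁ + j₃ = j₂ + j₄ then expc ((v a - v b) / 2 *
        ((j₁ : ℝ) ^ 2 - (j₂ : ℝ) ^ 2 + (j₃ : ℝ) ^ 2 - (j₄ : ℝ) ^ 2)) else 0).re := by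
    intro v
    simp only [pairSum, Complex.re_sum]
  simp only [hsum]
  rw [integral_finsetSum _ fun j₁ _ => (continuous_finsetSum _ fun j₂ _ =>
    continuous_finsetSum _ fun j₃ _ => continuous_finsetSum _ fun j₄ _ =>
      hterm j₁ j₂ j₃ j₄).integrable_cubeMeasure]
  have hle : ∀ j₁ ∈ Finset.Icc 1 N, ∫ v : Fin M → ℝ, ∑ j₂ ∈ Finset.Icc 1 N,
        ∑ j₃ ∈ Finset.Icc 1 N, ∑ j₄ ∈ Finset.Icc 1 N,
        (if j₁ + j₃ = j₂ + j₄ then expc ((v a - v b) / 2 *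
        ((j₁ : ℝ) ^ 2 - (j₂ : ℝ) ^ 2 + (j₃ : ℝ) ^ 2 - (j₄ : ℝ) ^ 2)) else 0).re ∂cubeMeasure M ≤
      ∑ j₂ ∈ Finset.Icc 1 N, ∑ j₃ ∈ Finset.Icc 1 N, ∑ j₄ ∈ Finset.Icc 1 N,
      (2 : ℝ) ^ M * ((if j₁ = j₂ then 1 else 0) * (if j₃ = j₄ then 1 else 0) +
        (if j₁ = j₄ then 1 else 0) * (if j₃ = j₂ then 1 else 0)) := by
    intro j₁ _
    rw [integral_finsetSum _ fun j₂ _ => (continuous_finsetSum _ fun j₃ _ =>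
      continuous_finsetSum _ fun j₄ _ => hterm j₁ j₂ j₃ j₄).integrable_cubeMeasure]
    refine Finset.sum_le_sum fun j₂ _ => ?_
    rw [integral_finsetSum _ fun j₃ _ => (continuous_finsetSum _ fun j₄ _ =>
      hterm j₁ j₂ j₃ j₄).integrable_cubeMeasure]
    refine Finset.sum_le_sum fun j₃ _ => ?_
    rw [integral_finsetSum _ fun j₄ _ => (hterm j₁ j₂ j₃ j₄).integrable_cubeMeasure]
    exact Finset.sum_le_sum fun j₄ _ => hbound j₁ j₂ j₃ j₄
  refine (Finset.sum_le_sum hle).trans (le_of_eq ?_)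
  simp only [← Finset.mul_sum]
  congr 1
  have h₁ : ∀ j₁ ∈ Finset.Icc 1 N, ∑ j₂ ∈ Finset.Icc 1 N, ∑ j₃ ∈ Finset.Icc 1 N,
      ∑ j₄ ∈ Finset.Icc 1 N,
      (((if j₁ = j₂ then 1 else 0) * (if j₃ = j₄ then 1 else 0) +
        (if j₁ = j₄ then 1 else 0) * (if j₃ = j₂ then 1 else 0) : ℝ)) = 2 * N := by
    intro j₁ h₁
    have e₁ : ∑ j ∈ Finset.Icc 1 N, (if j₁ = j then (1 : ℝ) else 0) = 1 := by
      rw [Finset.sum_ite_eq, if_pos h₁]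
    have e₂ : ∑ i ∈ Finset.Icc 1 N, ∑ j ∈ Finset.Icc 1 N, (if i = j then (1 : ℝ) else 0) = N := by
      have h : ∀ i ∈ Finset.Icc 1 N, ∑ j ∈ Finset.Icc 1 N, (if i = j then (1 : ℝ) else 0) = 1 :=
        fun i hi => by rw [Finset.sum_ite_eq, if_pos hi]
      rw [Finset.sum_congr rfl h]
      simp
    have e₃ : ∑ j ∈ Finset.Icc 1 N, ∑ i ∈ Finset.Icc 1 N, (if i = j then (1 : ℝ) else 0) = N := by
      rw [Finset.sum_comm, e₂]
    simp only [Finset.sum_add_distrib, ← Finset.mul_sum, ← Finset.sum_mul, e₁, e₂, e₃]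
    ring
  rw [Finset.sum_congr rfl h₁]
  simp
  ring

/-- The part of the exponential sum (before normalisation) coming from distinct frequencies. -/
noncomputable def offDiagonalSum (N M : ℕ) (v : Fin M → ℝ) : ℝ :=
  ∑ a, ∑ b, if a = b then 0 else (pairSum N (v a - v b)).re

lemma offDiagonalSum_nonneg (N M : ℕ) (v : Fin M → ℝ) : 0 ≤ offDiagonalSum N M v := by
  refine Finset.sum_nonneg fun a _ => Finset.sum_nonneg fun b _ => ?_
  split_ifs
  · exact le_rfl
  · exact pairSum_re_nonneg _ _

lemma continuous_offDiagonalSum_term (N M : ℕ) (a b : Fin M) :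
    Continuous fun v : Fin M → ℝ => if a = b then 0 else (pairSum N (v a - v b)).re := by
  split_ifs
  · exact continuous_const
  · exact Complex.continuous_re.comp ((continuous_pairSum N).comp (by fun_prop))

lemma continuous_offDiagonalSum (N M : ℕ) : Continuous (offDiagonalSum N M) :=
  continuous_finsetSum _ fun a _ => continuous_finsetSum _ fun b _ =>
    continuous_offDiagonalSum_term N M a b

lemma integral_offDiagonalSum_le (N M : ℕ) :
    ∫ v, offDiagonalSum N M v ∂cubeMeasure M ≤ 2 ^ M * (2 * (M : ℝ) ^ 2 * (N : ℝ) ^ 2) := by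
  unfold offDiagonalSum
  rw [integral_finsetSum _ fun a _ => (continuous_finsetSum _ fun b _ =>
    continuous_offDiagonalSum_term N M a b).integrable_cubeMeasure]
  have h : ∀ a : Fin M, ∫ v, ∑ b, (if a = b then 0 else (pairSum N (v a - v b)).re)
      ∂cubeMeasure M ≤ ∑ _b : Fin M, (2 : ℝ) ^ M * (2 * (N : ℝ) ^ 2) := by
    intro a
    rw [integral_finsetSum _ fun b _ =>
      (continuous_offDiagonalSum_term N M a b).integrable_cubeMeasure]
    refine Finset.sum_le_sum fun b _ => ?_
    by_cases hab : a = b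
    · simp only [if_pos hab, integral_zero]
      positivity
    · simp only [if_neg hab]
      exact integral_pairSum_re_le N hab
  refine (Finset.sum_le_sum fun a _ => h a).trans (le_of_eq ?_)
  simp
  ring

lemma sum_Icc_extFin {E : Type*} [AddCommMonoid E] (M : ℕ) (v : Fin M → ℝ) (f : ℝ → E) :
    ∑ i ∈ Finset.Icc 1 M, f (extFin M v i) = ∑ a, f (v a) := by
  rw [← Finset.Ico_add_one_right_eq_Icc, Finset.sum_Ico_eq_sum_range, ← Fin.sum_univ_eq_sum_range
    (fun i => f (extFin M v (1 + i)))]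
  refine Finset.sum_congr rfl fun a _ => ?_
  simp [extFin]

lemma ES_re_le (ρ : ℝ) (N M : ℕ) (hM : M = ⌊ρ * (N : ℝ)⌋₊) (v : Fin M → ℝ) :
    (ES ρ (extFin M v) N).re ≤ ((N : ℝ) ^ 5)⁻¹ * (M * (N : ℝ) ^ 3 + offDiagonalSum N M v) := by
  have h : ES ρ (extFin M v) N = (((N : ℝ) ^ 5)⁻¹ : ℝ) * ∑ a, ∑ b, pairSum N (v a - v b) := by
    rw [← sum_Icc_extFin M v fun x => ∑ b, pairSum N (x - v b)]
    simp only [← fun x => sum_Icc_extFin M v fun y => pairSum N (x - y)]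
    rw [ES, ← hM]
    push_cast
    rfl
  rw [h, Complex.re_ofReal_mul]
  gcongr
  simp only [Complex.re_sum, offDiagonalSum]
  have hdiag : (M * (N : ℝ) ^ 3) = ∑ a : Fin M, ∑ b : Fin M, if a = b then (N : ℝ) ^ 3 else 0 := by
    simp
  rw [hdiag, ← Finset.sum_add_distrib]
  refine Finset.sum_le_sum fun a _ => ?_
  rw [← Finset.sum_add_distrib]
  refine Finset.sum_le_sum fun b _ => ?_
  split_ifs
  · simpa using pairSum_re_le N _
  · simp

lemma cubeMeasure_real_le_add_offDiagonalSum (N M : ℕ) {c ε : ℝ} (hc : 0 ≤ c) :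
    ε * (cubeMeasure M).real {v | ε ≤ c + offDiagonalSum N M v} ≤
      2 ^ M * (c + 2 * (M : ℝ) ^ 2 * (N : ℝ) ^ 2) := by
  refine (mul_meas_ge_le_integral_of_nonneg
    (.of_forall fun v => add_nonneg hc (offDiagonalSum_nonneg N M v))
    (continuous_const.add (continuous_offDiagonalSum N M)).integrable_cubeMeasure ε).trans ?_
  rw [integral_add (integrable_const _) (continuous_offDiagonalSum N M).integrable_cubeMeasure,
    integral_const, cubeMeasure_real_univ, smul_eq_mul, mul_add]
  gcongr
  exact integral_offDiagonalSum_le N M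

theorem statement8 (ρ : ℝ) (hρ : 0 < ρ) (N M : ℕ) (hN : 1 ≤ N)
    (hM : M = ⌊ρ * (N : ℝ)⌋₊) (hM1 : 1 ≤ M) (δ : ℝ) (hδ : δ ∈ Set.Ioo (0 : ℝ) 1) :
    ((2 : ℝ≥0∞) ^ M)⁻¹ *
      volume {v ∈ Set.univ.pi fun _ : Fin M => Set.Icc (0 : ℝ) 2 |
        (N : ℝ) ^ (-δ) < (ES ρ (extFin M v) N).re}
      ≤ ENNReal.ofReal (16 * ρ ^ 2 * (N : ℝ) ^ (δ - 1)) := by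
  have hn : (1 : ℝ) ≤ N := by exact_mod_cast hN
  have hn0 : (0 : ℝ) < N := by linarith
  have hMρ : (M : ℝ) ≤ ρ * N := by
    rw [hM]
    exact Nat.floor_le (by positivity)
  set n : ℝ := (N : ℝ) with hndef
  set t : ℝ := n ^ (-δ) with ht
  have ht0 : 0 < t := Real.rpow_pos_of_pos hn0 _
  have hnt : 1 ≤ n * t := by
    have h : n * t = n ^ (1 - δ) := by
      rw [sub_eq_add_neg, Real.rpow_add hn0, Real.rpow_one]
    rw [h]
    exact Real.one_le_rpow hn (by linarith [hδ.2])
  have hpow : n ^ (δ - 1) = (n * t)⁻¹ := by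
    rw [ht, sub_eq_add_neg, Real.rpow_add hn0, Real.rpow_neg_one, Real.rpow_neg hn0.le, mul_inv,
      inv_inv, mul_comm]
  -- A point of the set has a large off-diagonal part, up to the diagonal contribution.
  have hlt : ∀ v : Fin M → ℝ, t < (ES ρ (extFin M v) N).re →
      n ^ 5 * t ≤ M * n ^ 3 + offDiagonalSum N M v := by
    intro v hv
    have h := hv.le.trans (ES_re_le ρ N M hM v)
    rwa [le_inv_mul_iff₀ (by positivity)] at h
  have hreal : (cubeMeasure M).real {v | t < (ES ρ (extFin M v) N).re} ≤
      2 ^ M * (16 * ρ ^ 2 * n ^ (δ - 1)) := by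
    have hdiag : (M : ℝ) * n ^ 3 ≤ ρ * n ^ 4 := by
      calc (M : ℝ) * n ^ 3 ≤ ρ * n * n ^ 3 := by gcongr
        _ = ρ * n ^ 4 := by ring
    have hoff : 2 * (M : ℝ) ^ 2 * n ^ 2 ≤ 2 * ρ ^ 2 * n ^ 4 := by
      calc 2 * (M : ℝ) ^ 2 * n ^ 2 ≤ 2 * (ρ * n) ^ 2 * n ^ 2 := by gcongr
        _ = 2 * ρ ^ 2 * n ^ 4 := by ring
    suffices h : n ^ 5 * t * (cubeMeasure M).real {v | t < (ES ρ (extFin M v) N).re} ≤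
        2 ^ M * (16 * ρ ^ 2 * n ^ 4) by
      rw [← le_div_iff₀' (by positivity)] at h
      refine h.trans (le_of_eq ?_)
      rw [hpow]
      field_simp
    rcases le_total ρ (1 / 2) with hρ2 | hρ2
    · have hsub : {v : Fin M → ℝ | t < (ES ρ (extFin M v) N).re} ⊆
          {v | n ^ 5 * t / 2 ≤ 0 + offDiagonalSum N M v} := by
        intro v hv
        have h1 := hlt v hv
        have h2 : ρ * n ^ 4 ≤ 1 / 2 * (n ^ 4 * (n * t)) := by
          have : n ^ 4 ≤ n ^ 4 * (n * t) := le_mul_of_one_le_right (by positivity) hnt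
          calc ρ * n ^ 4 ≤ 1 / 2 * n ^ 4 := by gcongr
            _ ≤ _ := by gcongr
        have h3 : n ^ 4 * (n * t) = n ^ 5 * t := by ring
        rw [Set.mem_ofPred_eq]
        linarith
      have h1 := cubeMeasure_real_le_add_offDiagonalSum N M (ε := n ^ 5 * t / 2) le_rfl
      have h2 : n ^ 5 * t / 2 * (cubeMeasure M).real {v | t < (ES ρ (extFin M v) N).re} ≤
          2 ^ M * (2 * ρ ^ 2 * n ^ 4) := by
        refine (mul_le_mul_of_nonneg_left (measureReal_mono hsub) (by positivity)).trans
          (h1.trans ?_)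
        gcongr
        linarith
      have h3 : (0 : ℝ) ≤ 2 ^ M * (ρ ^ 2 * n ^ 4) := by positivity
      linarith
    · have h1 := cubeMeasure_real_le_add_offDiagonalSum N M (ε := n ^ 5 * t)
        (c := M * n ^ 3) (by positivity)
      refine (mul_le_mul_of_nonneg_left (measureReal_mono hlt) (by positivity)).trans
        (h1.trans ?_)
      gcongr
      have h2 : ρ * n ^ 4 ≤ 2 * ρ ^ 2 * n ^ 4 := by
        gcongr
        nlinarith
      have h3 : 0 ≤ ρ ^ 2 * n ^ 4 := by positivity
      linarith
  have hset : volume {v ∈ Set.univ.pi fun _ : Fin M => Set.Icc (0 : ℝ) 2 |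
      t < (ES ρ (extFin M v) N).re} = cubeMeasure M {v | t < (ES ρ (extFin M v) N).re} := by
    rw [cubeMeasure_eq_restrict, Measure.restrict_apply'
      (MeasurableSet.univ_pi fun _ => measurableSet_Icc), Set.inter_comm]
    rfl
  rw [hset, ← ofReal_measureReal, ENNReal.inv_mul_le_iff (by simp) (by simp)]
  refine (ENNReal.ofReal_le_ofReal hreal).trans (le_of_eq ?_)
  rw [ENNReal.ofReal_mul (by positivity), ENNReal.ofReal_pow (by norm_num), ENNReal.ofReal_ofNat]
end

section
/- There exist a constant δ' > 0 and an integer N₀ such that for every integer N ≥ N₀ there exists N' ∈ {N, ⌊8N/7⌋} with (4/(π²·(N')³)) · Σ_{1 ≤ j₁, j₂ ≤ N', j₁ ≠ j₂} ( ‖4·N'·√2·(j₁² − j₂²)‖_T / ‖4·√2·(j₁² − j₂²)‖_T )² ≥ δ'. (The denominators are nonzero since √2 is irrational and j₁ ≠ j₂.) -/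
open scoped BigOperators

/-- If `θ` is within `4 / N` of an integer but is not one, then the multiples of `θ` by `N` and by
`⌊8 N / 7⌋` cannot both be much closer to an integer than `N * distT θ`. -/
theorem sq_le_distT_ratio_sq_add {θ : ℝ} {N : ℕ} (hN : 100 ≤ N) (hpos : 0 < distT θ)
    (hle : N * distT θ ≤ 4) :
    ((N : ℝ) / 100) ^ 2 ≤ (distT (N * θ) / distT θ) ^ 2 +
      (distT (((8 * N / 7 : ℕ) : ℝ) * θ) / distT θ) ^ 2 := by
  set M : ℕ := 8 * N / 7 with hM
  have hNR : (100 : ℝ) ≤ N := by exact_mod_cast hN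
  by_contra! hlt
  have h₁ : distT (N * θ) / distT θ < N / 100 :=
    lt_of_pow_lt_pow_left₀ 2 (by positivity) (by nlinarith [sq_nonneg (distT (M * θ) / distT θ)])
  have h₂ : distT (M * θ) / distT θ < N / 100 :=
    lt_of_pow_lt_pow_left₀ 2 (by positivity) (by nlinarith [sq_nonneg (distT (N * θ) / distT θ)])
  rw [div_lt_iff₀ hpos] at h₁ h₂
  have hM₁ : (7 : ℝ) * M ≤ 8 * N := by exact_mod_cast (by omega : 7 * M ≤ 8 * N)
  have hM₂ : (8 : ℝ) * N ≤ 7 * M + 6 := by exact_mod_cast (by omega : 8 * N ≤ 7 * M + 6)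
  obtain ⟨s, hs⟩ : ∃ s : ℝ, s = θ - round θ := ⟨_, rfl⟩
  obtain ⟨k, hk⟩ : ∃ k : ℤ, k = round (N * θ) - N * round θ := ⟨_, rfl⟩
  obtain ⟨l, hl⟩ : ∃ l : ℤ, l = round (M * θ) - M * round θ := ⟨_, rfl⟩
  have hk' : distT (N * θ) = |N * s - k| := by
    rw [distT, hs, hk]; push_cast; congr 1; ring
  have hl' : distT (M * θ) = |M * s - l| := by
    rw [distT, hs, hl]; push_cast; congr 1; ring
  have ht : distT θ = |s| := by rw [distT, hs]
  rw [hk', ht] at h₁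
  rw [hl', ht] at h₂
  rw [ht] at hle hpos
  have hs_small : |s| ≤ 4 / 100 := by nlinarith
  have hNs : |N * s| ≤ 4 := by rwa [abs_mul, Nat.abs_cast]
  have h₁' : |N * s - k| < 4 / 100 := by linarith
  have h₂' : |M * s - l| < 4 / 100 := by linarith
  have he : |(8 * N - 7 * M) * s| ≤ 6 * (4 / 100) := by
    rw [abs_mul, abs_of_nonneg (by linarith : (0 : ℝ) ≤ 8 * N - 7 * M)]
    gcongr
    linarith
  rw [abs_le] at hNs he
  rw [abs_lt] at h₁' h₂'
  have hk_lt : k < 5 := by exact_mod_cast (by linarith : (k : ℝ) < 5)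
  have hk_gt : -5 < k := by exact_mod_cast (by linarith : (-5 : ℝ) < k)
  have hlk_lt : 7 * l - 8 * k < 1 := by
    exact_mod_cast (by linarith : 7 * (l : ℝ) - 8 * k < 1)
  have hlk_gt : -1 < 7 * l - 8 * k := by
    exact_mod_cast (by linarith : -1 < 7 * (l : ℝ) - 8 * k)
  have hk0 : k = 0 := by omega
  rw [hk0, Int.cast_zero, sub_zero, abs_mul, Nat.abs_cast] at h₁
  nlinarith

theorem distT_pos_of_irrational {x : ℝ} (hx : Irrational x) : 0 < distT x :=
  abs_pos.2 (sub_ne_zero.2 (hx.ne_int _))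

/-- The parametrization `j₁ = a + b a`, `j₂ = a - b a` embeds a sum over `a` in a sum over
off-diagonal pairs. -/
theorem sum_add_sub_le_sum_offDiag {A : Finset ℕ} {b : ℕ → ℕ} {K : ℕ} (f : ℕ → ℕ → ℝ)
    (hf : ∀ i j, 0 ≤ f i j) (hb : ∀ a ∈ A, 0 < b a ∧ b a < a ∧ a + b a ≤ K) :
    ∑ a ∈ A, f (a + b a) (a - b a) ≤
      ∑ i ∈ Finset.Icc 1 K, ∑ j ∈ Finset.Icc 1 K, if i ≠ j then f i j else 0 := by
  rw [← Finset.sum_product' (f := fun i j => if i ≠ j then f i j else 0)]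
  have hinj : Set.InjOn (fun a => (a + b a, a - b a)) (A : Set ℕ) := by
    intro x hx y hy hxy
    have := hb x hx
    have := hb y hy
    simp only [Prod.mk.injEq] at hxy
    omega
  calc ∑ a ∈ A, f (a + b a) (a - b a)
      = ∑ p ∈ A.image (fun a => (a + b a, a - b a)), if p.1 ≠ p.2 then f p.1 p.2 else 0 := by
        rw [Finset.sum_image hinj]
        refine Finset.sum_congr rfl fun a ha => ?_
        have := hb a ha
        rw [if_pos (by dsimp only; omega)]
    _ ≤ _ := by
        refine Finset.sum_le_sum_of_subset_of_nonneg ?_ fun p _ _ => ?_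
        · intro p hp
          obtain ⟨a, ha, rfl⟩ := Finset.mem_image.1 hp
          have := hb a ha
          simp only [Finset.mem_product, Finset.mem_Icc]
          omega
        · split_ifs
          exacts [hf _ _, le_rfl]

/-- Dirichlet approximation: every `a` admits some `0 < b ≤ N / 4` such that
`16 √2 a b` lies within `4 / N` of an integer. -/
theorem exists_distT_sqrt_two_mul_le (N : ℕ) (hN : 100 ≤ N) (a : ℕ) :
    ∃ b : ℕ, 0 < b ∧ b ≤ N / 4 ∧ N * distT (16 * √2 * a * b) ≤ 4 := by
  obtain ⟨b, hb, hbN, h⟩ :=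
    Real.exists_nat_abs_mul_sub_round_le (16 * √2 * a) (by omega : 0 < N / 4)
  refine ⟨b, hb, hbN, ?_⟩
  rw [mul_comm (b : ℝ)] at h
  have hQ : (N : ℝ) ≤ 4 * ((N / 4 : ℕ) + 1) := by
    exact_mod_cast (by omega : N ≤ 4 * (N / 4 + 1))
  calc N * distT (16 * √2 * a * b)
      ≤ (4 * ((N / 4 : ℕ) + 1)) * (1 / ((N / 4 : ℕ) + 1)) := by
        gcongr
        exacts [abs_nonneg _, h]
    _ = 4 := by field_simp

theorem statement11 :
    ∃ δ' : ℝ, 0 < δ' ∧ ∃ N₀ : ℕ, ∀ N : ℕ, N₀ ≤ N →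
      ∃ N' : ℕ, (N' = N ∨ N' = 8 * N / 7) ∧
        δ' ≤ 4 / (Real.pi ^ 2 * (N' : ℝ) ^ 3) *
          ∑ j₁ ∈ Finset.Icc 1 N', ∑ j₂ ∈ Finset.Icc 1 N',
            (if j₁ ≠ j₂ then
              (distT (4 * (N' : ℝ) * Real.sqrt 2 * ((j₁ : ℝ) ^ 2 - (j₂ : ℝ) ^ 2)) /
                distT (4 * Real.sqrt 2 * ((j₁ : ℝ) ^ 2 - (j₂ : ℝ) ^ 2))) ^ 2
            else 0) := by
  refine ⟨4 / Real.pi ^ 2 / 1280000, by positivity, 100, fun N hN => ?_⟩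
  choose b hb_pos hb_le hb using exists_distT_sqrt_two_mul_le N hN
  let f (K i j : ℕ) : ℝ := (distT (4 * (K : ℝ) * √2 * ((i : ℝ) ^ 2 - (j : ℝ) ^ 2)) /
    distT (4 * √2 * ((i : ℝ) ^ 2 - (j : ℝ) ^ 2))) ^ 2
  let A := Finset.Ioc (N / 4) (N / 2)
  have hA (K : ℕ) (hK : N ≤ K) (a : ℕ) (ha : a ∈ A) : 0 < b a ∧ b a < a ∧ a + b a ≤ K := by
    have := hb_pos a
    have := hb_le a
    have := Finset.mem_Ioc.1 ha
    omega
  have hf (K a : ℕ) (ha : a ∈ A) : f K (a + b a) (a - b a) =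
      (distT (K * (16 * √2 * a * b a)) / distT (16 * √2 * a * b a)) ^ 2 := by
    simp only [f]
    rw [Nat.cast_sub (hA N le_rfl a ha).2.1.le, Nat.cast_add]
    congr 3 <;> ring
  have hterm (a : ℕ) (ha : a ∈ A) : ((N : ℝ) / 100) ^ 2 ≤
      f N (a + b a) (a - b a) + f (8 * N / 7) (a + b a) (a - b a) := by
    rw [hf _ a ha, hf _ a ha]
    refine sq_le_distT_ratio_sq_add hN (distT_pos_of_irrational ?_) (hb a)
    have hne : 16 * a * b a ≠ 0 := by
      have := hA N le_rfl a ha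
      have : a ≠ 0 := by omega
      have : b a ≠ 0 := by omega
      positivity
    convert irrational_sqrt_two.natCast_mul hne using 1
    push_cast
    ring
  have hcard : (N : ℝ) / 8 ≤ A.card := by
    rw [Nat.card_Ioc, div_le_iff₀ (by norm_num)]
    exact_mod_cast (by omega : N ≤ (N / 2 - N / 4) * 8)
  have hsum : (N : ℝ) / 8 * (N / 100) ^ 2 ≤
      ∑ a ∈ A, f N (a + b a) (a - b a) + ∑ a ∈ A, f (8 * N / 7) (a + b a) (a - b a) := by
    rw [← Finset.sum_add_distrib]
    refine le_trans ?_ (Finset.card_nsmul_le_sum A _ _ hterm)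
    rw [nsmul_eq_mul]
    gcongr
  have hNpos : (0 : ℝ) < N := by exact_mod_cast (by omega : 0 < N)
  have key (K : ℕ) (hNK : N ≤ K) (hKN : K ≤ 2 * N)
      (h : (N : ℝ) ^ 3 / 160000 ≤ ∑ a ∈ A, f K (a + b a) (a - b a)) :
      4 / Real.pi ^ 2 / 1280000 ≤ 4 / (Real.pi ^ 2 * (K : ℝ) ^ 3) *
        ∑ i ∈ Finset.Icc 1 K, ∑ j ∈ Finset.Icc 1 K, if i ≠ j then f K i j else 0 := by
    have hKpos : (0 : ℝ) < K := by exact_mod_cast (by omega : 0 < K)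
    have hKR : (K : ℝ) ≤ 2 * N := by exact_mod_cast hKN
    have hK3 : (K : ℝ) ^ 3 ≤ (2 * N) ^ 3 := by gcongr
    calc 4 / Real.pi ^ 2 / 1280000
        = 4 / (Real.pi ^ 2 * (K : ℝ) ^ 3) * ((K : ℝ) ^ 3 / 1280000) := by field_simp
      _ ≤ _ := by
        gcongr
        refine le_trans (by linarith) (h.trans
          (sum_add_sub_le_sum_offDiag (f K) (fun _ _ => sq_nonneg _) (hA K hNK)))
  rcases le_total ((N : ℝ) ^ 3 / 160000) (∑ a ∈ A, f N (a + b a) (a - b a)) with h | h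
  · exact ⟨N, Or.inl rfl, key N le_rfl (by omega) h⟩
  · exact ⟨8 * N / 7, Or.inr rfl, key _ (by omega) (by omega) (by linarith)⟩
end
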